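/- Let R ∈ (0,∞], let a be a locally finite nonnegative Borel measure on [0,R), let b : [0,R) → ℝ be locally square-integrable, and let ξ > 0. Then the boundary-value problem (★) has exactly one solution φ. -/

import Mathlib

open MeasureTheory Filter Set
open scoped ENNReal Topology

noncomputable section

/-- The interval `[0, R)` as a subset of `ℝ`, where `R ∈ (0, ∞]`. -/
def IsetOf (R : ℝ≥0∞) : Set ℝ := {y : ℝ | 0 ≤ y ∧ ENNReal.ofReal y < R}

/-- `a` is a locally finite nonnegative Borel measure on `[0, R)`:
it is carried by `[0, R)` and finite on compact subsets of `[0, R)`. -/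
def LocallyFiniteOnHalf (R : ℝ≥0∞) (a : MeasureTheory.Measure ℝ) : Prop :=
  a ((IsetOf R)ᶜ) = 0 ∧ ∀ y ∈ IsetOf R, a (Set.Icc 0 y) < ⊤

/-- `b` is locally square-integrable on `[0, R)`. -/
def LocL2OnHalf (R : ℝ≥0∞) (b : ℝ → ℝ) : Prop :=
  ∀ y ∈ IsetOf R, MeasureTheory.IntegrableOn (fun t => (b t) ^ 2) (Set.Icc 0 y)

/-- A solution `φ` (with right-continuous locally-BV version `v` of `φ′`) of the
boundary-value problem (★) for data `(R, a, b, ξ)`: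
`φ` is locally absolutely continuous on `[0, R)` with a.e. derivative `v`; `φ(0) = 1`;
`φ` is bounded on `[0, R)`; `φ(y) → 0` as `y → R⁻` when `R < ∞`; and the distributional
second derivative of `φ` is the locally finite measure determined by
`(1/2) φ″(dy) = (1/2) ξ² φ(y) a(dy) + (1/2) ξ² φ(y) b(y)² dy − i ξ φ′(y) b(y) dy` on `(0, R)`,
expressed here through the increments of `v`. -/
structure IsStarSolution (R : ℝ≥0∞) (a : MeasureTheory.Measure ℝ) (b : ℝ → ℝ) (ξ : ℝ)
    (φ : ℝ → ℂ) (v : ℝ → ℂ) : Prop where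
  init : φ 0 = 1
  deriv_integrable : ∀ y ∈ IsetOf R, MeasureTheory.IntegrableOn v (Set.Icc 0 y)
  locAC : ∀ y ∈ IsetOf R, φ y = 1 + ∫ t in (0:ℝ)..y, v t
  right_cont : ∀ y ∈ IsetOf R, 0 < y → ContinuousWithinAt v (Set.Ici y) y
  bounded : ∃ M : ℝ, ∀ y ∈ IsetOf R, ‖φ y‖ ≤ M
  boundary : R ≠ ⊤ →
    Filter.Tendsto φ (nhdsWithin R.toReal (Set.Iio R.toReal)) (nhds 0)
  integ_a : ∀ y ∈ IsetOf R, MeasureTheory.IntegrableOn φ (Set.Icc 0 y) a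
  integ_vb : ∀ y ∈ IsetOf R,
    MeasureTheory.IntegrableOn (fun t => v t * (b t : ℂ)) (Set.Icc 0 y)
  integ_φb : ∀ y ∈ IsetOf R,
    MeasureTheory.IntegrableOn (fun t => φ t * (b t : ℂ) ^ 2) (Set.Icc 0 y)
  eqn : ∀ y₁ y₂ : ℝ, 0 < y₁ → y₁ ≤ y₂ → y₂ ∈ IsetOf R →
    v y₂ - v y₁ = (ξ : ℂ) ^ 2 * ∫ y in Set.Ioc y₁ y₂, φ y ∂a
      + ∫ t in y₁..y₂,
          ((ξ : ℂ) ^ 2 * φ t * (b t : ℂ) ^ 2 - 2 * Complex.I * (ξ : ℂ) * v t * (b t : ℂ))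

theorem integral_mul_integral_eq_add {α β : Measure ℝ} [SFinite α] [SFinite β] {g h : ℝ → ℂ}
    (hg : Integrable g α) (hh : Integrable h β) :
    Integrable (fun s => (∫ t in Iio s, h t ∂β) * g s) α ∧
    Integrable (fun t => h t * ∫ s in Iic t, g s ∂α) β ∧
    (∫ t, h t ∂β) * (∫ s, g s ∂α)
      = (∫ s, (∫ t in Iio s, h t ∂β) * g s ∂α) + ∫ t, h t * (∫ s in Iic t, g s ∂α) ∂β := by
  have hF : Integrable (fun z : ℝ × ℝ => g z.1 * h z.2) (α.prod β) := hg.mul_prod hh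
  have hA : MeasurableSet {z : ℝ × ℝ | z.2 < z.1} := measurableSet_lt measurable_snd measurable_fst
  have h1 := hF.indicator hA
  have h2 := hF.indicator hA.compl
  have e1 : ∀ s, ∫ t, {z : ℝ × ℝ | z.2 < z.1}.indicator (fun z => g z.1 * h z.2) (s, t) ∂β
      = (∫ t in Iio s, h t ∂β) * g s := by
    intro s
    rw [← integral_indicator measurableSet_Iio, ← integral_mul_const]
    congr 1; ext t
    by_cases hts : t < s <;> simp [indicator, hts, mul_comm]
  have e2 : ∀ t, ∫ s, {z : ℝ × ℝ | z.2 < z.1}ᶜ.indicator (fun z => g z.1 * h z.2) (s, t) ∂α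
      = h t * ∫ s in Iic t, g s ∂α := by
    intro t
    rw [← integral_indicator measurableSet_Iic, ← integral_const_mul]
    congr 1; ext s
    by_cases hts : t < s <;> simp [indicator, hts, mul_comm]
  refine ⟨?_, ?_, ?_⟩
  · simpa only [e1] using h1.integral_prod_left
  · simpa only [e2] using h2.integral_prod_right
  · rw [mul_comm, ← integral_prod_mul, ← integral_add_compl hA hF, ← integral_indicator hA,
      ← integral_indicator hA.compl, integral_prod _ h1, integral_prod_symm _ h2]
    simp only [e1, e2]

theorem integral_Ioc_mul_integral_Ioc {α : Measure ℝ} {x y : ℝ} (hα : α (Ioc x y) < ⊤)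
    {g h : ℝ → ℂ} (hg : IntegrableOn g (Ioc x y) α) (hh : IntegrableOn h (Ioc x y)) :
    IntegrableOn (fun s => (∫ t in Ioc x s, h t) * g s) (Ioc x y) α ∧
    IntegrableOn (fun t => h t * ∫ s in Ioc x t, g s ∂α) (Ioc x y) ∧
    (∫ t in Ioc x y, h t) * (∫ s in Ioc x y, g s ∂α)
      = (∫ s in Ioc x y, (∫ t in Ioc x s, h t) * g s ∂α)
        + ∫ t in Ioc x y, h t * (∫ s in Ioc x t, g s ∂α) := by
  have : IsFiniteMeasure (α.restrict (Ioc x y)) := ⟨by simpa using hα⟩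
  obtain ⟨h1, h2, h3⟩ := integral_mul_integral_eq_add (α := α.restrict (Ioc x y))
    (β := volume.restrict (Ioc x y)) hg hh
  have e1 : ∀ s ∈ Ioc x y, (∫ t in Iio s, h t ∂(volume.restrict (Ioc x y))) * g s
      = (∫ t in Ioc x s, h t) * g s := by
    intro s hs
    rw [Measure.restrict_restrict measurableSet_Iio, integral_Ioc_eq_integral_Ioo]
    congr 3
    ext t; simp only [mem_inter_iff, mem_Iio, mem_Ioc, mem_Ioo] at hs ⊢
    grind
  have e2 : ∀ t ∈ Ioc x y, h t * (∫ s in Iic t, g s ∂(α.restrict (Ioc x y)))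
      = h t * ∫ s in Ioc x t, g s ∂α := by
    intro t ht
    rw [Measure.restrict_restrict measurableSet_Iic]
    congr 3
    ext t; simp only [mem_inter_iff, mem_Iic, mem_Ioc] at ht ⊢
    grind
  refine ⟨(integrableOn_congr_fun e1 measurableSet_Ioc).1 h1,
    (integrableOn_congr_fun e2 measurableSet_Ioc).1 h2, ?_⟩
  rw [h3, setIntegral_congr_fun measurableSet_Ioc e1, setIntegral_congr_fun measurableSet_Ioc e2]

theorem tendsto_integral_Ioc_right {α : Measure ℝ} {x y : ℝ} (hxy : x < y) {g : ℝ → ℂ}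
    (hg : IntegrableOn g (Ioc x y) α) :
    Tendsto (fun z => ∫ s in Ioc x z, g s ∂α) (𝓝[≥] x) (𝓝 0) := by
  have key : Tendsto (fun z => ∫ s in Ioc x y, (Iic z).indicator g s ∂α) (𝓝[≥] x)
      (𝓝 (∫ s in Ioc x y, (0 : ℂ) ∂α)) := by
    refine tendsto_integral_filter_of_dominated_convergence (fun s => ‖g s‖) ?_ ?_ hg.norm ?_
    · exact Eventually.of_forall fun z => hg.aestronglyMeasurable.indicator measurableSet_Iic
    · exact Eventually.of_forall fun z => Eventually.of_forall fun s => norm_indicator_le_norm_self _ _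
    · refine (ae_restrict_iff' measurableSet_Ioc).2 (Eventually.of_forall fun s hs => ?_)
      refine tendsto_const_nhds.congr' ?_
      filter_upwards [mem_nhdsWithin_of_mem_nhds (Iio_mem_nhds hs.1)] with z hz
      simp only [mem_Iio] at hz
      simp [indicator, hz]
  simp only [integral_zero] at key
  refine key.congr' ?_
  filter_upwards [mem_nhdsWithin_of_mem_nhds (Iio_mem_nhds hxy)] with z hz
  rw [setIntegral_indicator measurableSet_Iic]
  congr 2
  ext s; simp only [mem_inter_iff, mem_Iic, mem_Ioc, mem_Iio] at hz ⊢
  grind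

theorem zero_mem_IsetOf {R : ℝ≥0∞} (hR : 0 < R) : (0 : ℝ) ∈ IsetOf R := by
  simpa [IsetOf] using hR

theorem mem_IsetOf_of_le {R : ℝ≥0∞} {x y : ℝ} (hy : y ∈ IsetOf R) (hx : 0 ≤ x) (hxy : x ≤ y) :
    x ∈ IsetOf R :=
  ⟨hx, (ENNReal.ofReal_le_ofReal hxy).trans_lt hy.2⟩

theorem exists_gt_mem_IsetOf {R : ℝ≥0∞} {y : ℝ} (hy : y ∈ IsetOf R) : ∃ z ∈ IsetOf R, y < z := by
  obtain ⟨r, hr0, h1, h2⟩ := ENNReal.lt_iff_exists_real_btwn.1 hy.2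
  exact ⟨r, ⟨hr0, h2⟩, lt_of_not_ge fun h => absurd (ENNReal.ofReal_le_ofReal h) (not_le.2 h1)⟩

theorem convex_IsetOf (R : ℝ≥0∞) : Convex ℝ (IsetOf R) :=
  Set.OrdConnected.convex ⟨fun _ hx _ hy _ hz => mem_IsetOf_of_le hy (hx.1.trans hz.1) hz.2⟩

theorem sigmaFinite_of_locallyFiniteOnHalf {R : ℝ≥0∞} {a : Measure ℝ}
    (ha : LocallyFiniteOnHalf R a) : SigmaFinite a := by
  refine Measure.sigmaFinite_of_countable
    (S := insert (IsetOf R)ᶜ ((fun q : ℚ => Icc 0 (q : ℝ)) '' {q : ℚ | (q : ℝ) ∈ IsetOf R}))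
    (((Set.to_countable _).image _).insert _) ?_ ?_
  · rintro s (rfl | ⟨q, hq, rfl⟩)
    · simp [ha.1]
    · exact ha.2 _ hq
  · refine eq_univ_of_forall fun y => ?_
    by_cases hy : y ∈ IsetOf R
    · obtain ⟨z, hz, hyz⟩ := exists_gt_mem_IsetOf hy
      obtain ⟨q, h1, h2⟩ := exists_rat_btwn hyz
      exact ⟨_, Or.inr ⟨q, mem_IsetOf_of_le hz (hy.1.trans h1.le) h2.le, rfl⟩, hy.1, h1.le⟩
    · exact ⟨_, Or.inl rfl, hy⟩

theorem integrableOn_source_of {b : ℝ → ℝ} {p q : ℝ → ℂ} {s : Set ℝ} (ξ : ℝ)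
    (hp : IntegrableOn (fun t => p t * (b t : ℂ) ^ 2) s)
    (hq : IntegrableOn (fun t => q t * (b t : ℂ)) s) :
    IntegrableOn (fun t => (ξ : ℂ) ^ 2 * p t * (b t : ℂ) ^ 2
      - 2 * Complex.I * (ξ : ℂ) * q t * (b t : ℂ)) s := by
  refine ((hp.const_mul ((ξ : ℂ) ^ 2)).sub (hq.const_mul (2 * Complex.I * (ξ : ℂ)))).congr
    (Eventually.of_forall fun t => ?_)
  simp only [Pi.sub_apply]; ring

/-- Solutions of the linear equation underlying `IsStarSolution`, without normalisation or
boundary conditions. -/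
structure IsODESolution (R : ℝ≥0∞) (a : Measure ℝ) (b : ℝ → ℝ) (ξ : ℝ) (φ v : ℝ → ℂ) : Prop where
  int_v : ∀ y ∈ IsetOf R, IntegrableOn v (Icc 0 y)
  rep : ∀ y ∈ IsetOf R, φ y = φ 0 + ∫ t in (0 : ℝ)..y, v t
  int_a : ∀ y ∈ IsetOf R, IntegrableOn φ (Icc 0 y) a
  int_vb : ∀ y ∈ IsetOf R, IntegrableOn (fun t => v t * (b t : ℂ)) (Icc 0 y)
  int_φb : ∀ y ∈ IsetOf R, IntegrableOn (fun t => φ t * (b t : ℂ) ^ 2) (Icc 0 y)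
  eqn : ∀ y₁ y₂ : ℝ, 0 < y₁ → y₁ ≤ y₂ → y₂ ∈ IsetOf R →
    v y₂ - v y₁ = (ξ : ℂ) ^ 2 * ∫ y in Ioc y₁ y₂, φ y ∂a
      + ∫ t in y₁..y₂,
          ((ξ : ℂ) ^ 2 * φ t * (b t : ℂ) ^ 2 - 2 * Complex.I * (ξ : ℂ) * v t * (b t : ℂ))

theorem IsStarSolution.isODESolution {R : ℝ≥0∞} {a : Measure ℝ} {b : ℝ → ℝ} {ξ : ℝ} {φ v : ℝ → ℂ}
    (h : IsStarSolution R a b ξ φ v) : IsODESolution R a b ξ φ v where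
  int_v := h.deriv_integrable
  rep y hy := by rw [h.init, h.locAC y hy]
  int_a := h.integ_a
  int_vb := h.integ_vb
  int_φb := h.integ_φb
  eqn := h.eqn

namespace IsODESolution

variable {R : ℝ≥0∞} {a : Measure ℝ} {b : ℝ → ℝ} {ξ : ℝ} {φ v : ℝ → ℂ}

theorem integrableOn_source (h : IsODESolution R a b ξ φ v) {y : ℝ} (hy : y ∈ IsetOf R) :
    IntegrableOn (fun t => (ξ : ℂ) ^ 2 * φ t * (b t : ℂ) ^ 2
      - 2 * Complex.I * (ξ : ℂ) * v t * (b t : ℂ)) (Icc 0 y) :=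
  integrableOn_source_of ξ (h.int_φb y hy) (h.int_vb y hy)

theorem add_const_mul {φ₂ v₂ : ℝ → ℂ} (h₁ : IsODESolution R a b ξ φ v)
    (h₂ : IsODESolution R a b ξ φ₂ v₂) (c : ℂ) :
    IsODESolution R a b ξ (fun t => φ t + c * φ₂ t) (fun t => v t + c * v₂ t) where
  int_v y hy := (h₁.int_v y hy).add ((h₂.int_v y hy).const_mul c)
  rep y hy := by
    have i1 : IntervalIntegrable v volume 0 y :=
      (intervalIntegrable_iff_integrableOn_Icc_of_le hy.1).2 (h₁.int_v y hy)
    have i2 : IntervalIntegrable v₂ volume 0 y :=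
      (intervalIntegrable_iff_integrableOn_Icc_of_le hy.1).2 (h₂.int_v y hy)
    rw [intervalIntegral.integral_add i1 (i2.const_mul c), intervalIntegral.integral_const_mul,
      h₁.rep y hy, h₂.rep y hy]
    ring
  int_a y hy := (h₁.int_a y hy).add ((h₂.int_a y hy).const_mul c)
  int_vb y hy := by
    refine ((h₁.int_vb y hy).add ((h₂.int_vb y hy).const_mul c)).congr
      (Eventually.of_forall fun t => ?_)
    simp only [Pi.add_apply]; ring
  int_φb y hy := by
    refine ((h₁.int_φb y hy).add ((h₂.int_φb y hy).const_mul c)).congr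
      (Eventually.of_forall fun t => ?_)
    simp only [Pi.add_apply]; ring
  eqn y₁ y₂ hy₁ hy hy₂ := by
    have hs : Ioc y₁ y₂ ⊆ Icc 0 y₂ := fun t ht => ⟨(hy₁.trans ht.1).le, ht.2⟩
    have e : ∀ t, (ξ : ℂ) ^ 2 * (φ t + c * φ₂ t) * (b t : ℂ) ^ 2
        - 2 * Complex.I * (ξ : ℂ) * (v t + c * v₂ t) * (b t : ℂ)
        = ((ξ : ℂ) ^ 2 * φ t * (b t : ℂ) ^ 2 - 2 * Complex.I * (ξ : ℂ) * v t * (b t : ℂ))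
        + c * ((ξ : ℂ) ^ 2 * φ₂ t * (b t : ℂ) ^ 2 - 2 * Complex.I * (ξ : ℂ) * v₂ t * (b t : ℂ)) :=
      fun t => by ring
    have i1 := (intervalIntegrable_iff_integrableOn_Ioc_of_le hy).2
      ((h₁.integrableOn_source hy₂).mono_set hs)
    have i2 := (intervalIntegrable_iff_integrableOn_Ioc_of_le hy).2
      ((h₂.integrableOn_source hy₂).mono_set hs)
    simp only [e]
    rw [intervalIntegral.integral_add i1 (i2.const_mul c), intervalIntegral.integral_const_mul,
      integral_add ((h₁.int_a y₂ hy₂).mono_set hs) (((h₂.int_a y₂ hy₂).mono_set hs).const_mul c),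
      integral_const_mul]
    linear_combination h₁.eqn y₁ y₂ hy₁ hy hy₂ + c * h₂.eqn y₁ y₂ hy₁ hy hy₂

theorem continuousWithinAt_deriv (h : IsODESolution R a b ξ φ v) {x : ℝ} (hx : x ∈ IsetOf R)
    (heq : ∀ y ∈ IsetOf R, x ≤ y → v y - v x = (ξ : ℂ) ^ 2 * ∫ y in Ioc x y, φ y ∂a
      + ∫ t in x..y,
          ((ξ : ℂ) ^ 2 * φ t * (b t : ℂ) ^ 2 - 2 * Complex.I * (ξ : ℂ) * v t * (b t : ℂ))) :
    ContinuousWithinAt v (Ici x) x := by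
  obtain ⟨y, hy, hxy⟩ := exists_gt_mem_IsetOf hx
  have hs : Ioc x y ⊆ Icc 0 y := fun t ht => ⟨hx.1.trans ht.1.le, ht.2⟩
  have t1 := tendsto_integral_Ioc_right hxy ((h.int_a y hy).mono_set hs)
  have t2 := tendsto_integral_Ioc_right hxy ((h.integrableOn_source hy).mono_set hs)
  have t3 := ((t1.const_mul ((ξ : ℂ) ^ 2)).add t2).const_add (v x)
  simp only [mul_zero, add_zero] at t3
  refine t3.congr' ?_
  filter_upwards [self_mem_nhdsWithin, mem_nhdsWithin_of_mem_nhds (Iio_mem_nhds hxy)] with z hz hzy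
  have := heq z (mem_IsetOf_of_le hy (hx.1.trans hz) (le_of_lt hzy)) hz
  rw [intervalIntegral.integral_of_le hz] at this
  rw [← this]; ring

theorem sub_eq_integral (h : IsODESolution R a b ξ φ v) {x y : ℝ} (hx : 0 ≤ x) (hxy : x ≤ y)
    (hy : y ∈ IsetOf R) : φ y - φ x = ∫ t in Ioc x y, v t := by
  have hx' := mem_IsetOf_of_le hy hx hxy
  have i1 : IntervalIntegrable v volume 0 y :=
    (intervalIntegrable_iff_integrableOn_Icc_of_le hy.1).2 (h.int_v y hy)
  have i2 : IntervalIntegrable v volume 0 x :=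
    (intervalIntegrable_iff_integrableOn_Icc_of_le hx).2 (h.int_v x hx')
  rw [h.rep y hy, h.rep x hx', ← intervalIntegral.integral_of_le hxy,
    ← intervalIntegral.integral_interval_sub_left i1 i2]
  ring

end IsODESolution

namespace IsODESolution

variable {R : ℝ≥0∞} {a : Measure ℝ} {b : ℝ → ℝ} {ξ : ℝ} {φ v : ℝ → ℂ}

open ComplexConjugate in
theorem conj_sub_eq_integral (h : IsODESolution R a b ξ φ v) {x y : ℝ} (hx : 0 ≤ x) (hxy : x ≤ y)
    (hy : y ∈ IsetOf R) : conj (φ y) - conj (φ x) = ∫ t in Ioc x y, conj (v t) := by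
  rw [integral_conj, ← h.sub_eq_integral hx hxy hy, map_sub]

open ComplexConjugate in
theorem normSq_sub_eq_integral (h : IsODESolution R a b ξ φ v) {x y : ℝ} (hx : 0 ≤ x)
    (hxy : x ≤ y) (hy : y ∈ IsetOf R) :
    IntegrableOn (fun t => (conj (φ t) * v t).re) (Ioc x y) ∧
    ‖φ y‖ ^ 2 - ‖φ x‖ ^ 2 = ∫ t in Ioc x y, 2 * (conj (φ t) * v t).re := by
  have hv : IntegrableOn v (Ioc x y) :=
    (h.int_v y hy).mono_set fun t ht => ⟨hx.trans ht.1.le, ht.2⟩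
  have hcv : IntegrableOn (fun t => conj (v t)) (Ioc x y) := by
    refine hv.norm.mono' ?_ ?_
    · exact Complex.continuous_conj.comp_aestronglyMeasurable hv.aestronglyMeasurable
    · exact Eventually.of_forall fun t => by simp
  obtain ⟨i1, i2, e⟩ := integral_Ioc_mul_integral_Ioc (α := volume) (by simp) hv hcv
  have hI : ∀ t ∈ Ioc x y, t ∈ IsetOf R := fun t ht => mem_IsetOf_of_le hy (hx.trans ht.1.le) ht.2
  have c1 : ∀ s ∈ Ioc x y, (∫ t in Ioc x s, conj (v t)) * v s
      = (conj (φ s) - conj (φ x)) * v s := fun s hs => by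
    rw [h.conj_sub_eq_integral hx hs.1.le (hI s hs)]
  have c2 : ∀ s ∈ Ioc x y, conj (v s) * (∫ t in Ioc x s, v t)
      = conj (v s) * (φ s - φ x) := fun s hs => by
    rw [h.sub_eq_integral hx hs.1.le (hI s hs)]
  rw [setIntegral_congr_fun measurableSet_Ioc c1, setIntegral_congr_fun measurableSet_Ioc c2,
    ← h.sub_eq_integral hx hxy hy, ← h.conj_sub_eq_integral hx hxy hy] at e
  replace i1 := (integrableOn_congr_fun c1 measurableSet_Ioc).1 i1
  replace i2 := (integrableOn_congr_fun c2 measurableSet_Ioc).1 i2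
  have j1 : IntegrableOn (fun t => conj (φ t) * v t) (Ioc x y) := by
    refine (i1.add (hv.const_mul (conj (φ x)))).congr (Eventually.of_forall fun t => ?_)
    simp only [Pi.add_apply]; ring
  refine ⟨j1.re, ?_⟩
  have key : conj (φ y) * φ y - conj (φ x) * φ x
      = ∫ t in Ioc x y, ((conj (φ t) - conj (φ x)) * v t + conj (v t) * (φ t - φ x)
        + (conj (φ x) * v t + conj (v t) * φ x)) := by
    have i3 : IntegrableOn (fun t => (conj (φ t) - conj (φ x)) * v t + conj (v t) * (φ t - φ x))
      (Ioc x y) := i1.add i2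
    have i4 : IntegrableOn (fun t => conj (φ x) * v t + conj (v t) * φ x) (Ioc x y) :=
      (hv.const_mul _).add (hcv.mul_const _)
    rw [integral_add i3 i4, integral_add i1 i2,
      integral_add (hv.const_mul _) (hcv.mul_const _), ← e, integral_const_mul, integral_mul_const,
      ← h.sub_eq_integral hx hxy hy, ← h.conj_sub_eq_integral hx hxy hy]
    ring
  have key2 : conj (φ y) * φ y - conj (φ x) * φ x
      = ∫ t in Ioc x y, ((2 * (conj (φ t) * v t).re : ℝ) : ℂ) := by
    rw [key]
    congr 1; ext t
    apply Complex.ext <;> simp <;> ring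
  rw [integral_complex_ofReal] at key2
  rw [← Complex.ofReal_inj, ← key2]
  simp [Complex.conj_mul']

open ComplexConjugate in
theorem re_conj_mul_deriv_mono (h : IsODESolution R a b ξ φ v)
    (ha : LocallyFiniteOnHalf R a) {x y : ℝ} (hx : 0 < x) (hxy : x ≤ y) (hy : y ∈ IsetOf R) :
    (conj (φ x) * v x).re ≤ (conj (φ y) * v y).re := by
  have hs : Ioc x y ⊆ Icc 0 y := fun t ht => ⟨hx.le.trans ht.1.le, ht.2⟩
  have hI : ∀ t ∈ Ioc x y, t ∈ IsetOf R := fun t ht =>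
    mem_IsetOf_of_le hy (hx.le.trans ht.1.le) ht.2
  have hv : IntegrableOn v (Ioc x y) := (h.int_v y hy).mono_set hs
  have hcv : IntegrableOn (fun t => conj (v t)) (Ioc x y) := by
    refine hv.norm.mono' ?_ ?_
    · exact Complex.continuous_conj.comp_aestronglyMeasurable hv.aestronglyMeasurable
    · exact Eventually.of_forall fun t => by simp
  have hφa : IntegrableOn φ (Ioc x y) a := (h.int_a y hy).mono_set hs
  set f : ℝ → ℂ := fun t => (ξ : ℂ) ^ 2 * φ t * (b t : ℂ) ^ 2
      - 2 * Complex.I * (ξ : ℂ) * v t * (b t : ℂ) with hf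
  have hfi : IntegrableOn f (Ioc x y) := (h.integrableOn_source hy).mono_set hs
  obtain ⟨i1, i2, e1⟩ := integral_Ioc_mul_integral_Ioc (α := a)
    ((measure_mono hs).trans_lt (ha.2 y hy)) hφa hcv
  obtain ⟨i3, i4, e2⟩ := integral_Ioc_mul_integral_Ioc (α := volume) (by simp) hfi hcv
  have c1 : ∀ s ∈ Ioc x y, (∫ t in Ioc x s, conj (v t)) * φ s
      = (conj (φ s) - conj (φ x)) * φ s := fun s hs => by
    rw [h.conj_sub_eq_integral hx.le hs.1.le (hI s hs)]
  have c2 : ∀ s ∈ Ioc x y, (∫ t in Ioc x s, conj (v t)) * f s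
      = (conj (φ s) - conj (φ x)) * f s := fun s hs => by
    rw [h.conj_sub_eq_integral hx.le hs.1.le (hI s hs)]
  have hvs : ∀ s, x ≤ s → s ≤ y → v s - v x = (ξ : ℂ) ^ 2 * ∫ t in Ioc x s, φ t ∂a
      + ∫ t in Ioc x s, f t := fun s hs hsy => by
    rw [h.eqn x s hx hs (mem_IsetOf_of_le hy (hx.le.trans hs) hsy),
      intervalIntegral.integral_of_le hs]
  rw [setIntegral_congr_fun measurableSet_Ioc c1, ← h.conj_sub_eq_integral hx.le hxy hy] at e1
  rw [setIntegral_congr_fun measurableSet_Ioc c2, ← h.conj_sub_eq_integral hx.le hxy hy] at e2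
  replace i1 := (integrableOn_congr_fun c1 measurableSet_Ioc).1 i1
  replace i3 := (integrableOn_congr_fun c2 measurableSet_Ioc).1 i3
  have k1 : IntegrableOn (fun t => conj (φ t) * φ t) (Ioc x y) a := by
    refine (i1.add (hφa.const_mul (conj (φ x)))).congr (Eventually.of_forall fun t => ?_)
    simp only [Pi.add_apply]; ring
  have k3 : IntegrableOn (fun t => conj (φ t) * f t) (Ioc x y) := by
    refine (i3.add (hfi.const_mul (conj (φ x)))).congr (Eventually.of_forall fun t => ?_)
    simp only [Pi.add_apply]; ring
  have c4 : ∀ s ∈ Ioc x y, (ξ : ℂ) ^ 2 * (conj (v s) * ∫ t in Ioc x s, φ t ∂a)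
      + conj (v s) * (∫ t in Ioc x s, f t) = conj (v s) * (v s - v x) := fun s hs => by
    rw [hvs s hs.1.le hs.2]; ring
  have i5 := (integrableOn_congr_fun c4 measurableSet_Ioc).1 ((i2.const_mul ((ξ : ℂ) ^ 2)).add i4)
  have e5 : (∫ s in Ioc x y, conj (v s) * (v s - v x))
      = (ξ : ℂ) ^ 2 * (∫ s in Ioc x y, conj (v s) * ∫ t in Ioc x s, φ t ∂a)
        + ∫ s in Ioc x y, conj (v s) * (∫ t in Ioc x s, f t) := by
    rw [← setIntegral_congr_fun measurableSet_Ioc c4, integral_add (i2.const_mul _) i4,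
      integral_const_mul]
  have k5 : IntegrableOn (fun t => conj (v t) * v t) (Ioc x y) := by
    refine (i5.add (hcv.mul_const (v x))).congr (Eventually.of_forall fun t => ?_)
    simp only [Pi.add_apply]; ring
  have s1 : (∫ s in Ioc x y, (conj (φ s) - conj (φ x)) * φ s ∂a)
      = (∫ s in Ioc x y, conj (φ s) * φ s ∂a) - conj (φ x) * ∫ s in Ioc x y, φ s ∂a := by
    rw [← integral_const_mul, ← integral_sub k1 (hφa.const_mul _)]
    simp only [sub_mul]
  have s2 : (∫ s in Ioc x y, (conj (φ s) - conj (φ x)) * f s)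
      = (∫ s in Ioc x y, conj (φ s) * f s) - conj (φ x) * ∫ s in Ioc x y, f s := by
    rw [← integral_const_mul, ← integral_sub k3 (hfi.const_mul _)]
    simp only [sub_mul]
  have s3 : (∫ s in Ioc x y, conj (v s) * (v s - v x))
      = (∫ s in Ioc x y, conj (v s) * v s) - (∫ s in Ioc x y, conj (v s)) * v x := by
    rw [← integral_mul_const, ← integral_sub k5 (hcv.mul_const _)]
    simp only [mul_sub]
  rw [← h.conj_sub_eq_integral hx.le hxy hy] at s3
  have key : conj (φ y) * v y - conj (φ x) * v x
      = (ξ : ℂ) ^ 2 * (∫ s in Ioc x y, conj (φ s) * φ s ∂a)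
        + ∫ s in Ioc x y, (conj (φ s) * f s + conj (v s) * v s) := by
    rw [integral_add k3 k5]
    linear_combination (conj (φ y)) * hvs y hxy le_rfl + (ξ : ℂ) ^ 2 * e1 + e2 - e5 + s3
      + (ξ : ℂ) ^ 2 * s1 + s2
  have r1 : (∫ s in Ioc x y, conj (φ s) * φ s ∂a)
      = ((∫ s in Ioc x y, ‖φ s‖ ^ 2 ∂a : ℝ) : ℂ) := by
    rw [← integral_complex_ofReal]
    simp [Complex.conj_mul']
  have r2 : 0 ≤ (∫ s in Ioc x y, (conj (φ s) * f s + conj (v s) * v s)).re := by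
    have := integral_re (k3.add k5)
    simp only [Pi.add_apply, RCLike.re_eq_complex_re] at this
    rw [← this]
    refine integral_nonneg fun s => ?_
    have : (conj (φ s) * f s + conj (v s) * v s).re
        = (ξ * b s * (φ s).re + (v s).im) ^ 2 + (ξ * b s * (φ s).im - (v s).re) ^ 2 := by
      simp [hf, ← Complex.ofReal_pow]
      ring
    rw [this]
    positivity
  have r3 : 0 ≤ ((ξ : ℂ) ^ 2 * (∫ s in Ioc x y, conj (φ s) * φ s ∂a)).re := by
    rw [r1, ← Complex.ofReal_pow, ← Complex.ofReal_mul, Complex.ofReal_re]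
    exact mul_nonneg (sq_nonneg _) (integral_nonneg fun s => by positivity)
  have := congrArg Complex.re key
  rw [Complex.sub_re, Complex.add_re] at this
  linarith

open ComplexConjugate in
theorem convexOn_normSq (h : IsODESolution R a b ξ φ v) (ha : LocallyFiniteOnHalf R a) :
    ConvexOn ℝ (IsetOf R) fun y => ‖φ y‖ ^ 2 := by
  refine convexOn_of_slope_mono_adjacent (convex_IsetOf R) fun {x y z} hx hz hxy hyz => ?_
  have hy := mem_IsetOf_of_le hz (hx.1.trans hxy.le) hyz.le
  have hy0 : 0 < y := hx.1.trans_lt hxy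
  obtain ⟨i1, e1⟩ := h.normSq_sub_eq_integral hx.1 hxy.le hy
  obtain ⟨i2, e2⟩ := h.normSq_sub_eq_integral hy.1 hyz.le hz
  trans 2 * (conj (φ y) * v y).re
  · rw [div_le_iff₀ (sub_pos.2 hxy), e1]
    calc _ ≤ ∫ t in Ioc x y, 2 * (conj (φ y) * v y).re := by
          refine setIntegral_mono_on (i1.const_mul 2) (integrableOn_const (by simp))
            measurableSet_Ioc fun t ht => ?_
          exact mul_le_mul_of_nonneg_left
            (h.re_conj_mul_deriv_mono ha (hx.1.trans_lt ht.1) ht.2 hy) zero_le_two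
      _ = _ := by simp [hxy.le, mul_comm]
  · rw [le_div_iff₀ (sub_pos.2 hyz), e2]
    calc _ = ∫ t in Ioc y z, 2 * (conj (φ y) * v y).re := by simp [hyz.le, mul_comm]
      _ ≤ _ := by
          refine setIntegral_mono_on (integrableOn_const (by simp)) (i2.const_mul 2)
            measurableSet_Ioc fun t ht => ?_
          exact mul_le_mul_of_nonneg_left (h.re_conj_mul_deriv_mono ha hy0 ht.1.le
            (mem_IsetOf_of_le hz (hy0.le.trans ht.1.le) ht.2)) zero_le_two

end IsODESolution

theorem ConvexOn.le_lerp {s : Set ℝ} {p : ℝ → ℝ} (hp : ConvexOn ℝ s p) {y r : ℝ} (h0 : 0 ∈ s)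
    (hr : r ∈ s) (hr0 : 0 < r) (hy : 0 ≤ y) (hyr : y ≤ r) :
    p y ≤ (1 - y / r) * p 0 + y / r * p r := by
  have := hp.2 h0 hr (sub_nonneg.2 (div_le_one_of_le₀ hyr hr0.le)) (div_nonneg hy hr0.le)
    (sub_add_cancel 1 (y / r))
  simpa [hr0.ne'] using this

theorem eq_zero_of_convexOn {R : ℝ≥0∞} {p : ℝ → ℝ} (hp : ConvexOn ℝ (IsetOf R) p)
    (hpos : ∀ y, 0 ≤ p y) (h0 : p 0 = 0) (hbdd : ∃ M : ℝ, ∀ y ∈ IsetOf R, p y ≤ M)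
    (hlim : R ≠ ⊤ → Tendsto p (𝓝[<] R.toReal) (𝓝 0)) {y : ℝ} (hy : y ∈ IsetOf R) : p y = 0 := by
  have h0I : (0 : ℝ) ∈ IsetOf R := mem_IsetOf_of_le hy le_rfl hy.1
  have key : ∀ z ∈ IsetOf R, y < z → p y ≤ y / z * p z := fun z hz hyz => by
    simpa [h0] using hp.le_lerp h0I hz (hy.1.trans_lt hyz) hy.1 hyz.le
  refine le_antisymm ?_ (hpos y)
  by_cases hR : R = ⊤
  · obtain ⟨M, hM⟩ := hbdd
    have t : Tendsto (fun z : ℝ => y / z * M) atTop (𝓝 0) := by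
      simpa using (tendsto_id.const_div_atTop y).mul_const M
    refine ge_of_tendsto t ?_
    filter_upwards [eventually_gt_atTop y] with z hz
    have hz0 : 0 ≤ z := hy.1.trans hz.le
    have hzI : z ∈ IsetOf R := ⟨hz0, by simp [hR]⟩
    exact (key z hzI hz).trans (mul_le_mul_of_nonneg_left (hM z hzI) (div_nonneg hy.1 hz0))
  · have hyR : y < R.toReal := (ENNReal.ofReal_lt_iff_lt_toReal hy.1 hR).1 hy.2
    refine ge_of_tendsto (hlim hR) ?_
    filter_upwards [self_mem_nhdsWithin, mem_nhdsWithin_of_mem_nhds (Ioi_mem_nhds hyR)] with z h1 h2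
    have hz0 : 0 ≤ z := hy.1.trans (le_of_lt h2)
    refine (key z ⟨hz0, (ENNReal.ofReal_lt_iff_lt_toReal hz0 hR).2 h1⟩ h2).trans ?_
    exact mul_le_of_le_one_left (hpos z) (div_le_one_of_le₀ (le_of_lt h2) hz0)

theorem stronglyMeasurable_integral_Ioc {α : Measure ℝ} [SFinite α] {f : ℝ → ℂ}
    (hf : StronglyMeasurable f) (x : ℝ) :
    StronglyMeasurable fun y => ∫ s in Ioc x y, f s ∂α := by
  have e : (fun y => ∫ s in Ioc x y, f s ∂α)
      = fun y => ∫ s, {z : ℝ × ℝ | x < z.2 ∧ z.2 ≤ z.1}.indicator (fun z => f z.2) (y, s) ∂α := by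
    ext y
    rw [← integral_indicator measurableSet_Ioc]
    rfl
  rw [e]
  refine StronglyMeasurable.integral_prod_right' ?_
  refine (hf.comp_measurable measurable_snd).indicator ?_
  exact (measurableSet_lt measurable_const measurable_snd).inter
    (measurableSet_le measurable_snd measurable_fst)

theorem integrableOn_bdd_mul {α : Measure ℝ} {s : Set ℝ} (hs : MeasurableSet s) {f g : ℝ → ℂ}
    (hf : StronglyMeasurable f) {K : ℝ} (hK : ∀ t ∈ s, ‖f t‖ ≤ K) (hg : IntegrableOn g s α) :
    IntegrableOn (fun t => f t * g t) s α := by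
  refine (hg.norm.const_mul K).mono' (hf.aestronglyMeasurable.mul hg.aestronglyMeasurable) ?_
  refine (ae_restrict_iff' hs).2 (Eventually.of_forall fun t ht => ?_)
  rw [norm_mul]
  exact mul_le_mul_of_nonneg_right (hK t ht) (norm_nonneg _)

theorem integral_Ioc_sub_integral_Ioc {α : Measure ℝ} {f : ℝ → ℂ} {x y z : ℝ} (hxy : x ≤ y)
    (hyz : y ≤ z) (hf : IntegrableOn f (Ioc x z) α) :
    (∫ s in Ioc x z, f s ∂α) - ∫ s in Ioc x y, f s ∂α = ∫ s in Ioc y z, f s ∂α := by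
  rw [← Ioc_union_Ioc_eq_Ioc hxy hyz, setIntegral_union (Ioc_disjoint_Ioc_of_le le_rfl)
    measurableSet_Ioc (hf.mono_set (Ioc_subset_Ioc_right hyz))
    (hf.mono_set (Ioc_subset_Ioc_left hxy))]
  ring

theorem integral_Ioc_exp_le {c : ℝ} (hc : 0 < c) {y : ℝ} (hy : 0 ≤ y) :
    ∫ s in Ioc 0 y, Real.exp (c * s) ≤ Real.exp (c * y) / c := by
  rw [← intervalIntegral.integral_of_le hy,
    intervalIntegral.integral_comp_mul_left (fun s => Real.exp s) hc.ne', integral_exp,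
    smul_eq_mul, inv_mul_eq_div]
  gcongr
  simp

theorem integrableOn_exp_Ioc (c y : ℝ) : IntegrableOn (fun s => Real.exp (c * s)) (Ioc 0 y) :=
  (by fun_prop : Continuous fun s => Real.exp (c * s)).integrableOn_Ioc

theorem norm_integral_Ioc_le_exp {c M y : ℝ} (hc : 0 < c) (hy : 0 ≤ y) {f : ℝ → ℂ}
    (hM : 0 ≤ M) (hf : ∀ s ∈ Ioc 0 y, ‖f s‖ ≤ M * Real.exp (c * s)) :
    ‖∫ s in Ioc 0 y, f s‖ ≤ M * (Real.exp (c * y) / c) := by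
  refine (norm_integral_le_of_norm_le ((integrableOn_exp_Ioc c y).const_mul M)
    ((ae_restrict_iff' measurableSet_Ioc).2 (Eventually.of_forall hf))).trans ?_
  rw [integral_const_mul]
  exact mul_le_mul_of_nonneg_left (integral_Ioc_exp_le hc hy) hM

/-- The primitive of `u` with value `φ₀` at the origin. -/
def primitive (φ₀ : ℂ) (u : ℝ → ℂ) (y : ℝ) : ℂ := φ₀ + ∫ t in Ioc 0 y, u t

/-- The right-hand side of the equation for the derivative, integrated from the origin. -/
def picard (a : Measure ℝ) (b : ℝ → ℝ) (ξ : ℝ) (φ₀ v₀ : ℂ) (u : ℝ → ℂ) (y : ℝ) : ℂ :=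
  v₀ + ((ξ : ℂ) ^ 2 * (∫ t in Ioc 0 y, primitive φ₀ u t ∂a)
    + ∫ t in Ioc 0 y, ((ξ : ℂ) ^ 2 * primitive φ₀ u t * (b t : ℂ) ^ 2
      - 2 * Complex.I * (ξ : ℂ) * u t * (b t : ℂ)))

theorem stronglyMeasurable_primitive (φ₀ : ℂ) {u : ℝ → ℂ} (hu : StronglyMeasurable u) :
    StronglyMeasurable (primitive φ₀ u) :=
  stronglyMeasurable_const.add (stronglyMeasurable_integral_Ioc hu 0)

theorem norm_primitive_le (φ₀ : ℂ) {u : ℝ → ℂ} {r K : ℝ} (hK : ∀ t ∈ Icc 0 r, ‖u t‖ ≤ K) :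
    ∀ t ∈ Icc 0 r, ‖primitive φ₀ u t‖ ≤ ‖φ₀‖ + K * r := by
  intro t ht
  have hK0 : 0 ≤ K := (norm_nonneg _).trans (hK t ht)
  refine (norm_add_le _ _).trans (add_le_add_right ?_ _)
  refine (norm_setIntegral_le_of_norm_le_const (C := K) (by simp)
    fun s hs => hK s ⟨hs.1.le, hs.2.trans ht.2⟩).trans ?_
  rw [Real.volume_real_Ioc_of_le ht.1, sub_zero]
  exact mul_le_mul_of_nonneg_left ht.2 hK0

section Picard

variable {R : ℝ≥0∞} {a : Measure ℝ} {b : ℝ → ℝ}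

theorem LocL2OnHalf.integrableOn_sq (hb : LocL2OnHalf R b) {r : ℝ} (hr : r ∈ IsetOf R) :
    IntegrableOn (fun t => (b t : ℂ) ^ 2) (Icc 0 r) := by
  refine (hb r hr).ofReal.congr (Eventually.of_forall fun t => ?_)
  simp

theorem LocL2OnHalf.integrableOn (hb : LocL2OnHalf R b) (hbmeas : Measurable b) {r : ℝ}
    (hr : r ∈ IsetOf R) : IntegrableOn (fun t => (b t : ℂ)) (Icc 0 r) := by
  refine ((integrableOn_const (C := (1 : ℝ)) (by simp)).add (hb r hr)).mono'
    (Complex.measurable_ofReal.comp hbmeas).aestronglyMeasurable (Eventually.of_forall fun t => ?_)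
  simp only [Complex.norm_real, Real.norm_eq_abs, Pi.add_apply]
  nlinarith [sq_nonneg (|b t| - 1), sq_abs (b t), abs_nonneg (b t)]

theorem stronglyMeasurable_picard [SFinite a] (hbmeas : Measurable b) (ξ : ℝ) (φ₀ v₀ : ℂ)
    {u : ℝ → ℂ} (hu : StronglyMeasurable u) : StronglyMeasurable (picard a b ξ φ₀ v₀ u) := by
  have hb : StronglyMeasurable fun t => (b t : ℂ) :=
    (Complex.measurable_ofReal.comp hbmeas).stronglyMeasurable
  have hp := stronglyMeasurable_primitive φ₀ hu
  refine stronglyMeasurable_const.add ((stronglyMeasurable_const.mul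
    (stronglyMeasurable_integral_Ioc hp 0)).add (stronglyMeasurable_integral_Ioc ?_ 0))
  exact ((stronglyMeasurable_const.mul hp).mul (hb.pow 2)).sub
    ((stronglyMeasurable_const.mul hu).mul hb)

theorem integrableOn_picard_integrands (ha : LocallyFiniteOnHalf R a) (hbmeas : Measurable b)
    (hb : LocL2OnHalf R b) (φ₀ : ℂ) {u : ℝ → ℂ} (hu : StronglyMeasurable u)
    {r K : ℝ} (hr : r ∈ IsetOf R) (hK : ∀ t ∈ Icc 0 r, ‖u t‖ ≤ K) :
    IntegrableOn u (Icc 0 r) ∧ IntegrableOn (primitive φ₀ u) (Icc 0 r) a ∧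
    IntegrableOn (fun t => u t * (b t : ℂ)) (Icc 0 r) ∧
    IntegrableOn (fun t => primitive φ₀ u t * (b t : ℂ) ^ 2) (Icc 0 r) := by
  have hp := stronglyMeasurable_primitive φ₀ hu
  have hpK := norm_primitive_le φ₀ hK
  refine ⟨?_, ?_, integrableOn_bdd_mul measurableSet_Icc hu hK (hb.integrableOn hbmeas hr),
    integrableOn_bdd_mul measurableSet_Icc hp hpK (hb.integrableOn_sq hr)⟩
  · simpa using integrableOn_bdd_mul measurableSet_Icc hu hK
      (integrableOn_const (μ := volume) (C := (1 : ℂ)) (by simp))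
  · simpa using integrableOn_bdd_mul measurableSet_Icc hp hpK
      (integrableOn_const (μ := a) (C := (1 : ℂ)) (ha.2 r hr).ne)

theorem norm_picard_sub_picard_le (ha : LocallyFiniteOnHalf R a) (hbmeas : Measurable b)
    (hb : LocL2OnHalf R b) {ξ : ℝ} (hξ : 0 < ξ) (φ₀ v₀ : ℂ) {u w : ℝ → ℂ}
    (hu : StronglyMeasurable u) (hw : StronglyMeasurable w) {y K M c ε : ℝ} (hy : y ∈ IsetOf R)
    (huK : ∀ t ∈ Icc 0 y, ‖u t‖ ≤ K) (hwK : ∀ t ∈ Icc 0 y, ‖w t‖ ≤ K) (hM : 0 ≤ M) (hc : 0 < c)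
    (hε : 0 < ε) (hsub : ∀ t ∈ Icc 0 y, ‖u t - w t‖ ≤ M * Real.exp (c * t)) :
    ‖picard a b ξ φ₀ v₀ u y - picard a b ξ φ₀ v₀ w y‖ ≤ M * Real.exp (c * y) *
      (ξ ^ 2 * (a.real (Ioc 0 y) + ∫ t in Ioc 0 y, b t ^ 2) / c
        + ξ * (ε * (∫ t in Ioc 0 y, b t ^ 2) + 1 / (2 * c * ε))) := by
  obtain ⟨u1, u2, u3, u4⟩ := integrableOn_picard_integrands ha hbmeas hb φ₀ hu hy huK
  obtain ⟨w1, w2, w3, w4⟩ := integrableOn_picard_integrands ha hbmeas hb φ₀ hw hy hwK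
  have hs : Ioc 0 y ⊆ Icc 0 y := Ioc_subset_Icc_self
  have hb2 := (hb y hy).mono_set hs
  have hD : ∀ t ∈ Ioc 0 y,
      ‖primitive φ₀ u t - primitive φ₀ w t‖ ≤ M * (Real.exp (c * y) / c) := by
    intro t ht
    have ht' : Ioc 0 t ⊆ Icc 0 y := fun s hs => ⟨hs.1.le, hs.2.trans ht.2⟩
    have e : primitive φ₀ u t - primitive φ₀ w t = ∫ s in Ioc 0 t, (u s - w s) := by
      rw [integral_sub (u1.mono_set ht') (w1.mono_set ht')]
      simp [primitive]
    rw [e]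
    refine (norm_integral_Ioc_le_exp hc ht.1.le hM fun s hs => hsub s (ht' hs)).trans ?_
    gcongr
    exact ht.2
  have e : picard a b ξ φ₀ v₀ u y - picard a b ξ φ₀ v₀ w y
      = (ξ : ℂ) ^ 2 * (∫ t in Ioc 0 y, (primitive φ₀ u t - primitive φ₀ w t) ∂a)
      + ∫ t in Ioc 0 y, ((ξ : ℂ) ^ 2 * ((primitive φ₀ u t - primitive φ₀ w t) * (b t : ℂ) ^ 2)
        - 2 * Complex.I * (ξ : ℂ) * ((u t - w t) * (b t : ℂ))) := by
    rw [integral_sub (u2.mono_set hs) (w2.mono_set hs), picard, picard, add_sub_add_left_eq_sub,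
      add_sub_add_comm, ← integral_sub
      (integrableOn_source_of ξ (u4.mono_set hs) (u3.mono_set hs))
      (integrableOn_source_of ξ (w4.mono_set hs) (w3.mono_set hs)), mul_sub]
    congr 2; ext t; ring
  have n1 : ‖∫ t in Ioc 0 y, (primitive φ₀ u t - primitive φ₀ w t) ∂a‖
      ≤ M * (Real.exp (c * y) / c) * a.real (Ioc 0 y) :=
    norm_setIntegral_le_of_norm_le_const ((measure_mono hs).trans_lt (ha.2 y hy)) hD
  have n2 : ‖∫ t in Ioc 0 y, ((ξ : ℂ) ^ 2 * ((primitive φ₀ u t - primitive φ₀ w t) * (b t : ℂ) ^ 2)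
        - 2 * Complex.I * (ξ : ℂ) * ((u t - w t) * (b t : ℂ)))‖
      ≤ ∫ t in Ioc 0 y, ((ξ ^ 2 * (M * (Real.exp (c * y) / c)) + ξ * M * Real.exp (c * y) * ε)
          * b t ^ 2 + ξ * M / (Real.exp (c * y) * ε) * Real.exp (2 * c * t)) := by
    refine norm_integral_le_of_norm_le ((hb2.const_mul _).add
      ((integrableOn_exp_Ioc _ _).const_mul _)) ((ae_restrict_iff' measurableSet_Ioc).2
        (Eventually.of_forall fun t ht => ?_))
    refine (norm_sub_le _ _).trans ?_
    have m1 : ‖(ξ : ℂ) ^ 2 * ((primitive φ₀ u t - primitive φ₀ w t) * (b t : ℂ) ^ 2)‖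
        ≤ ξ ^ 2 * (M * (Real.exp (c * y) / c)) * b t ^ 2 := by
      simp only [norm_mul, norm_pow, Complex.norm_real, Real.norm_eq_abs, sq_abs]
      rw [mul_assoc]
      gcongr
      exact hD t ht
    have m2 : ‖2 * Complex.I * (ξ : ℂ) * ((u t - w t) * (b t : ℂ))‖
        ≤ 2 * ξ * (M * Real.exp (c * t) * |b t|) := by
      simp only [norm_mul, Complex.norm_real, Real.norm_eq_abs, Complex.norm_I, mul_one,
        Complex.norm_ofNat, abs_of_pos hξ]
      gcongr
      exact hsub t (hs ht)
    have m3 : 2 * Real.exp (c * t) * |b t|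
        ≤ Real.exp (c * y) * ε * b t ^ 2 + Real.exp (2 * c * t) / (Real.exp (c * y) * ε) := by
      have hE : 0 < Real.exp (c * y) * ε := by positivity
      have e2 : Real.exp (2 * c * t) = Real.exp (c * t) ^ 2 := by
        rw [← Real.exp_nat_mul]; congr 1; push_cast; ring
      rw [e2, ← sub_nonneg]
      have : Real.exp (c * y) * ε * b t ^ 2 + Real.exp (c * t) ^ 2 / (Real.exp (c * y) * ε)
          - 2 * Real.exp (c * t) * |b t|
          = (Real.exp (c * y) * ε * |b t| - Real.exp (c * t)) ^ 2 / (Real.exp (c * y) * ε) := by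
        rw [← sq_abs (b t)]
        field_simp
        ring
      rw [this]
      positivity
    have m4 := mul_le_mul_of_nonneg_left m3 (mul_nonneg hξ.le hM)
    calc _ ≤ _ := add_le_add m1 m2
      _ ≤ ξ ^ 2 * (M * (Real.exp (c * y) / c)) * b t ^ 2 + ξ * M * (Real.exp (c * y) * ε * b t ^ 2
          + Real.exp (2 * c * t) / (Real.exp (c * y) * ε)) := by linarith
      _ = _ := by ring
  rw [integral_add (hb2.const_mul _) ((integrableOn_exp_Ioc _ _).const_mul _), integral_const_mul,
    integral_const_mul] at n2
  have n3 : ξ * M / (Real.exp (c * y) * ε) * (∫ t in Ioc 0 y, Real.exp (2 * c * t))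
      ≤ ξ * M / (Real.exp (c * y) * ε) * (Real.exp (2 * c * y) / (2 * c)) :=
    mul_le_mul_of_nonneg_left (integral_Ioc_exp_le (by positivity) hy.1) (by positivity)
  have e2 : Real.exp (2 * c * y) = Real.exp (c * y) ^ 2 := by
    rw [← Real.exp_nat_mul]; congr 1; push_cast; ring
  rw [e]
  refine (norm_add_le _ _).trans ?_
  rw [norm_mul, norm_pow, Complex.norm_real, Real.norm_eq_abs, sq_abs]
  calc _ ≤ _ := add_le_add (mul_le_mul_of_nonneg_left n1 (sq_nonneg ξ))
        (n2.trans (add_le_add_right n3 _))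
    _ = _ := by
      rw [e2]
      field_simp
      ring

theorem exists_picard_contraction (ha : LocallyFiniteOnHalf R a) (hbmeas : Measurable b)
    (hb : LocL2OnHalf R b) {ξ : ℝ} (hξ : 0 < ξ) (φ₀ v₀ : ℂ) {r : ℝ} (hr : r ∈ IsetOf R) :
    ∃ c > 0, ∀ (u w : ℝ → ℂ) (K M : ℝ), StronglyMeasurable u → StronglyMeasurable w → 0 ≤ M →
      (∀ t ∈ Icc 0 r, ‖u t‖ ≤ K) → (∀ t ∈ Icc 0 r, ‖w t‖ ≤ K) →
      (∀ t ∈ Icc 0 r, ‖u t - w t‖ ≤ M * Real.exp (c * t)) →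
      ∀ y ∈ Icc 0 r, ‖picard a b ξ φ₀ v₀ u y - picard a b ξ φ₀ v₀ w y‖
        ≤ M / 2 * Real.exp (c * y) := by
  set A := a.real (Ioc 0 r) with hA
  set B := ∫ t in Ioc 0 r, b t ^ 2 with hB
  have hA0 : 0 ≤ A := measureReal_nonneg
  have hB0 : 0 ≤ B := integral_nonneg fun t => sq_nonneg _
  have hfin : a (Ioc 0 r) < ⊤ := (measure_mono Ioc_subset_Icc_self).trans_lt (ha.2 r hr)
  obtain ⟨c, hc, hc'⟩ : ∃ c > 0, 4 * (ξ ^ 2 * (A + B) + 2 * ξ ^ 2 * (B + 1)) ≤ c :=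
    ⟨4 * (ξ ^ 2 * (A + B) + 2 * ξ ^ 2 * (B + 1)), by positivity, le_rfl⟩
  refine ⟨c, hc, fun u w K M hu hw hM huK hwK hsub y hy => ?_⟩
  have hyr : Icc 0 y ⊆ Icc 0 r := Icc_subset_Icc_right hy.2
  have hε : 0 < 1 / (4 * ξ * (B + 1)) := by positivity
  refine (norm_picard_sub_picard_le ha hbmeas hb hξ φ₀ v₀ hu hw (mem_IsetOf_of_le hr hy.1 hy.2)
    (fun t ht => huK t (hyr ht)) (fun t ht => hwK t (hyr ht)) hM hc hε
    (fun t ht => hsub t (hyr ht))).trans ?_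
  have hAy : a.real (Ioc 0 y) ≤ A :=
    measureReal_mono (Ioc_subset_Ioc_right hy.2) hfin.ne
  have hBy : ∫ t in Ioc 0 y, b t ^ 2 ≤ B :=
    setIntegral_mono_set ((hb r hr).mono_set Ioc_subset_Icc_self)
      (Eventually.of_forall fun t => sq_nonneg _) (Ioc_subset_Ioc_right hy.2).eventuallyLE
  have hle : ξ ^ 2 * (a.real (Ioc 0 y) + ∫ t in Ioc 0 y, b t ^ 2) / c
        + ξ * (1 / (4 * ξ * (B + 1)) * (∫ t in Ioc 0 y, b t ^ 2)
          + 1 / (2 * c * (1 / (4 * ξ * (B + 1))))) ≤ 1 / 2 := by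
    calc _ ≤ ξ ^ 2 * (A + B) / c + ξ * (1 / (4 * ξ * (B + 1)) * B
          + 1 / (2 * c * (1 / (4 * ξ * (B + 1))))) := by gcongr
      _ = (ξ ^ 2 * (A + B) + 2 * ξ ^ 2 * (B + 1)) / c + 1 / 4 * (B / (B + 1)) := by
        field_simp
        ring
      _ ≤ 1 / 4 + 1 / 4 * 1 := by
        have h1 : (ξ ^ 2 * (A + B) + 2 * ξ ^ 2 * (B + 1)) / c ≤ 1 / 4 := by
          rw [div_le_iff₀ hc]; linarith
        have h2 : B / (B + 1) ≤ 1 := div_le_one_of_le₀ (by linarith) (by positivity)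
        linarith
      _ = 1 / 2 := by norm_num
  calc _ ≤ M * Real.exp (c * y) * (1 / 2) := by gcongr
    _ = _ := by ring

theorem exists_norm_picard_zero_le (ha : LocallyFiniteOnHalf R a)
    (hb : LocL2OnHalf R b) (ξ : ℝ) (φ₀ v₀ : ℂ) {r : ℝ} (hr : r ∈ IsetOf R) :
    ∃ G ≥ 0, ∀ y ∈ Icc 0 r, ‖picard a b ξ φ₀ v₀ 0 y‖ ≤ G := by
  have hfin : a (Ioc 0 r) < ⊤ := (measure_mono Ioc_subset_Icc_self).trans_lt (ha.2 r hr)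
  refine ⟨‖v₀‖ + (ξ ^ 2 * (‖φ₀‖ * a.real (Ioc 0 r))
    + ξ ^ 2 * ‖φ₀‖ * ∫ t in Ioc 0 r, b t ^ 2), ?_, fun y hy => ?_⟩
  · have : 0 ≤ ∫ t in Ioc 0 r, b t ^ 2 := integral_nonneg fun t => sq_nonneg _
    positivity
  have hBy : ∫ t in Ioc 0 y, b t ^ 2 ≤ ∫ t in Ioc 0 r, b t ^ 2 :=
    setIntegral_mono_set ((hb r hr).mono_set Ioc_subset_Icc_self)
      (Eventually.of_forall fun t => sq_nonneg _) (Ioc_subset_Ioc_right hy.2).eventuallyLE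
  have hp : primitive φ₀ 0 = fun _ => φ₀ := by ext; simp [primitive]
  refine (norm_add_le _ _).trans (add_le_add_right ((norm_add_le _ _).trans (add_le_add ?_ ?_)) _)
  · rw [hp, norm_mul, norm_pow, Complex.norm_real, Real.norm_eq_abs, sq_abs]
    gcongr
    refine (norm_setIntegral_le_of_norm_le_const
      ((measure_mono (Ioc_subset_Ioc_right hy.2)).trans_lt hfin) fun t _ => le_rfl).trans ?_
    exact mul_le_mul_of_nonneg_left (measureReal_mono (Ioc_subset_Ioc_right hy.2) hfin.ne)
      (norm_nonneg _)
  · refine le_trans ?_ (mul_le_mul_of_nonneg_left hBy (by positivity))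
    rw [← integral_const_mul]
    refine (norm_integral_le_integral_norm _).trans (le_of_eq ?_)
    simp [hp]

theorem exists_picard_fixedPoint (ha : LocallyFiniteOnHalf R a) (hbmeas : Measurable b)
    (hb : LocL2OnHalf R b) {ξ : ℝ} (hξ : 0 < ξ) (φ₀ v₀ : ℂ) :
    ∃ v : ℝ → ℂ, StronglyMeasurable v ∧ ∀ r ∈ IsetOf R, (∃ K, ∀ t ∈ Icc 0 r, ‖v t‖ ≤ K) ∧
      v r = picard a b ξ φ₀ v₀ v r := by
  have := sigmaFinite_of_locallyFiniteOnHalf ha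
  set S : ℕ → ℝ → ℂ := fun n => (picard a b ξ φ₀ v₀)^[n] 0 with hS
  have hS1 : ∀ n, S (n + 1) = picard a b ξ φ₀ v₀ (S n) := fun n =>
    Function.iterate_succ_apply' _ _ _
  have hmeas : ∀ n, StronglyMeasurable (S n) := by
    intro n
    induction n with
    | zero => exact stronglyMeasurable_zero
    | succ n ih => rw [hS1]; exact stronglyMeasurable_picard hbmeas ξ φ₀ v₀ ih
  set v : ℝ → ℂ := fun y => limUnder atTop fun n => S n y with hv
  have hvm : StronglyMeasurable v := StronglyMeasurable.limUnder hmeas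
  refine ⟨v, hvm, fun r hr => ?_⟩
  obtain ⟨c, hc, hcontr⟩ := exists_picard_contraction ha hbmeas hb hξ φ₀ v₀ hr
  obtain ⟨G, hG, hG'⟩ := exists_norm_picard_zero_le ha hb ξ φ₀ v₀ hr
  have hexp : ∀ t ∈ Icc 0 r, 1 ≤ Real.exp (c * t) ∧ Real.exp (c * t) ≤ Real.exp (c * r) :=
    fun t ht => ⟨Real.one_le_exp (mul_nonneg hc.le ht.1),
      Real.exp_le_exp.2 (mul_le_mul_of_nonneg_left ht.2 hc.le)⟩
  have hK : ∀ n, (∀ t ∈ Icc 0 r, ‖S n t‖ ≤ 2 * G * Real.exp (c * t)) := by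
    intro n
    induction n with
    | zero => intro t ht; simp only [hS, Function.iterate_zero, id, Pi.zero_apply, norm_zero]
              positivity
    | succ n ih =>
      intro t ht
      have h1 := hcontr (S n) 0 (2 * G * Real.exp (c * r)) (2 * G) (hmeas n)
        stronglyMeasurable_zero (by positivity)
        (fun t ht => (ih t ht).trans (mul_le_mul_of_nonneg_left (hexp t ht).2 (by positivity)))
        (fun t ht => by simp only [Pi.zero_apply, norm_zero]; positivity)
        (by simpa using ih) t ht
      have h2 := norm_le_norm_add_norm_sub (picard a b ξ φ₀ v₀ 0 t) (S (n + 1) t)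
      rw [norm_sub_rev, hS1] at h2
      rw [hS1]
      nlinarith [hG' t ht, (hexp t ht).1]
  have hK' : ∀ n, ∀ t ∈ Icc 0 r, ‖S n t‖ ≤ 2 * G * Real.exp (c * r) := fun n t ht =>
    (hK n t ht).trans (mul_le_mul_of_nonneg_left (hexp t ht).2 (by positivity))
  have hdiff : ∀ n, ∀ t ∈ Icc 0 r,
      ‖S n t - S (n + 1) t‖ ≤ 2 * G * (1 / 2) ^ n * Real.exp (c * t) := by
    intro n
    induction n with
    | zero => intro t ht; simpa [hS] using hK 1 t ht
    | succ n ih =>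
      intro t ht
      have := hcontr (S n) (S (n + 1)) _ _ (hmeas n) (hmeas (n + 1)) (by positivity) (hK' n)
        (hK' (n + 1)) ih t ht
      rw [← hS1, ← hS1] at this
      rw [pow_succ]
      linarith
  have hdist : ∀ t ∈ Icc 0 r, ∀ n,
      dist (S n t) (S (n + 1) t) ≤ 2 * G * Real.exp (c * t) * (1 / 2) ^ n := fun t ht n => by
    rw [dist_eq_norm]
    linarith [hdiff n t ht]
  have hlim : ∀ t ∈ Icc 0 r, Tendsto (fun n => S n t) atTop (𝓝 (v t)) := fun t ht =>
    (cauchySeq_of_le_geometric (1 / 2) _ (by norm_num) (hdist t ht)).tendsto_limUnder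
  have hvK : ∀ t ∈ Icc 0 r, ‖v t‖ ≤ 2 * G * Real.exp (c * r) := fun t ht =>
    le_of_tendsto (hlim t ht).norm (Eventually.of_forall fun n => hK' n t ht)
  have hSv : ∀ n, ∀ t ∈ Icc 0 r, ‖S n t - v t‖ ≤ 4 * G * (1 / 2) ^ n * Real.exp (c * t) := by
    intro n t ht
    have := dist_le_of_le_geometric_of_tendsto (1 / 2) _ (by norm_num) (hdist t ht) (hlim t ht) n
    rw [dist_eq_norm] at this
    refine this.trans (le_of_eq ?_)
    ring
  refine ⟨⟨_, hvK⟩, ?_⟩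
  have hrr : r ∈ Icc 0 r := ⟨hr.1, le_rfl⟩
  refine tendsto_nhds_unique ((tendsto_add_atTop_iff_nat 1).2 (hlim r hrr)) ?_
  rw [tendsto_iff_norm_sub_tendsto_zero]
  have ht0 : Tendsto (fun n : ℕ => 4 * G * (1 / 2 : ℝ) ^ n / 2 * Real.exp (c * r)) atTop (𝓝 0) := by
    have := tendsto_pow_atTop_nhds_zero_of_lt_one (r := (1 / 2 : ℝ)) (by norm_num) (by norm_num)
    simpa using ((this.const_mul (4 * G)).div_const 2).mul_const (Real.exp (c * r))
  refine squeeze_zero (fun n => norm_nonneg _) (fun n => ?_) ht0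
  rw [hS1]
  exact hcontr (S n) v _ _ (hmeas n) hvm (by positivity) (hK' n) hvK (hSv n) r hrr

theorem exists_isODESolution (hR : 0 < R) (ha : LocallyFiniteOnHalf R a) (hbmeas : Measurable b)
    (hb : LocL2OnHalf R b) {ξ : ℝ} (hξ : 0 < ξ) (φ₀ v₀ : ℂ) :
    ∃ φ v : ℝ → ℂ, IsODESolution R a b ξ φ v ∧ φ 0 = φ₀ ∧ v 0 = v₀ ∧
      ContinuousWithinAt v (Ici 0) 0 := by
  obtain ⟨v, hvm, hv⟩ := exists_picard_fixedPoint ha hbmeas hb hξ φ₀ v₀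
  have hintegral : ∀ y ∈ IsetOf R, _ := fun y hy =>
    integrableOn_picard_integrands ha hbmeas hb φ₀ hvm hy (hv y hy).1.choose_spec
  have hφ0 : primitive φ₀ v 0 = φ₀ := by simp [primitive]
  have heqn : ∀ y₁ y₂ : ℝ, 0 ≤ y₁ → y₁ ≤ y₂ → y₂ ∈ IsetOf R →
      v y₂ - v y₁ = (ξ : ℂ) ^ 2 * ∫ y in Ioc y₁ y₂, primitive φ₀ v y ∂a
      + ∫ t in y₁..y₂, ((ξ : ℂ) ^ 2 * primitive φ₀ v t * (b t : ℂ) ^ 2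
        - 2 * Complex.I * (ξ : ℂ) * v t * (b t : ℂ)) := by
    intro y₁ y₂ h1 h2 hy₂
    obtain ⟨i1, i2, i3, i4⟩ := hintegral y₂ hy₂
    have hs : Ioc 0 y₂ ⊆ Icc 0 y₂ := Ioc_subset_Icc_self
    have i5 := integrableOn_source_of ξ (i4.mono_set hs) (i3.mono_set hs)
    rw [(hv y₂ hy₂).2, (hv y₁ (mem_IsetOf_of_le hy₂ h1 h2)).2, intervalIntegral.integral_of_le h2,
      ← integral_Ioc_sub_integral_Ioc h1 h2 (i2.mono_set hs),
      ← integral_Ioc_sub_integral_Ioc h1 h2 i5, picard, picard]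
    ring
  have hsol : IsODESolution R a b ξ (primitive φ₀ v) v :=
    { int_v := fun y hy => (hintegral y hy).1
      rep := fun y hy => by rw [hφ0, intervalIntegral.integral_of_le hy.1]; rfl
      int_a := fun y hy => (hintegral y hy).2.1
      int_vb := fun y hy => (hintegral y hy).2.2.1
      int_φb := fun y hy => (hintegral y hy).2.2.2
      eqn := fun y₁ y₂ h1 => heqn y₁ y₂ h1.le }
  have h0 := zero_mem_IsetOf hR
  refine ⟨_, v, hsol, hφ0, ?_, hsol.continuousWithinAt_deriv h0 fun y hy h0y =>
    heqn 0 y le_rfl h0y hy⟩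
  rw [(hv 0 h0).2]
  simp [picard]

end Picard

theorem IsODESolution.ne_zero_of_deriv_zero_ne_zero {R : ℝ≥0∞} {a : Measure ℝ} {b : ℝ → ℝ} {ξ : ℝ}
    {φ v : ℝ → ℂ} (h : IsODESolution R a b ξ φ v) (ha : LocallyFiniteOnHalf R a) (h0 : φ 0 = 0)
    (hv0 : v 0 ≠ 0) (hvc : ContinuousWithinAt v (Ici 0) 0) {r : ℝ} (hr : r ∈ IsetOf R)
    (hr0 : 0 < r) : φ r ≠ 0 := by
  intro hφr
  have h0I : (0 : ℝ) ∈ IsetOf R := mem_IsetOf_of_le hr le_rfl hr0.le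
  have hz : ∀ y ∈ Icc 0 r, φ y = 0 := by
    intro y hy
    have := (h.convexOn_normSq ha).le_lerp h0I hr hr0 hy.1 hy.2
    simp only [h0, hφr, norm_zero] at this
    have h2 : ‖φ y‖ ^ 2 ≤ 0 := by simpa using this
    simpa using le_antisymm h2 (sq_nonneg _)
  have hd : HasDerivWithinAt (fun u => ∫ t in (0 : ℝ)..u, v t) (v 0) (Ici 0) 0 := by
    refine intervalIntegral.integral_hasDerivWithinAt_right (s := Ici 0) (t := Ioi 0) (by simp) ?_
      (hvc.mono Ioi_subset_Ici_self)
    refine ⟨Icc 0 r, mem_of_superset (Ioc_mem_nhdsGT hr0) Ioc_subset_Icc_self, ?_⟩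
    exact (h.int_v r hr).aestronglyMeasurable
  have hd0 : HasDerivWithinAt (fun u => ∫ t in (0 : ℝ)..u, v t) 0 (Ici 0) 0 := by
    refine (hasDerivWithinAt_const (0 : ℝ) (Ici 0) (0 : ℂ)).congr_of_eventuallyEq ?_ (by simp)
    filter_upwards [Icc_mem_nhdsGE hr0] with y hy
    have := h.rep y (mem_IsetOf_of_le hr hy.1 hy.2)
    rw [hz y hy, h0, zero_add] at this
    exact this.symm
  exact hv0 ((uniqueDiffWithinAt_Ici (0 : ℝ)).eq_deriv _ hd hd0)

theorem exists_slope {R : ℝ≥0∞} (hR : 0 < R) {a : Measure ℝ} {b : ℝ → ℝ} {ξ : ℝ}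
    {χ χ' θ θ' : ℝ → ℂ} (ha : LocallyFiniteOnHalf R a)
    (hχ : IsODESolution R a b ξ χ χ') (hθ : IsODESolution R a b ξ θ θ') (hχ0 : χ 0 = 1)
    (hθ0 : θ 0 = 0) (hθr : ∀ r ∈ IsetOf R, 0 < r → θ r ≠ 0) :
    ∃ c : ℂ, ∀ y ∈ IsetOf R, ‖χ y + c * θ y‖ ^ 2 ≤ 1 - y / R.toReal := by
  have h0 := zero_mem_IsetOf hR
  obtain ⟨r₀, hr₀, hr₀pos⟩ := exists_gt_mem_IsetOf h0
  let ι := {r : ℝ // r ∈ IsetOf R ∧ 0 < r}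
  have : Nonempty ι := ⟨⟨r₀, hr₀, hr₀pos⟩⟩
  let K : ι → Set ℂ := fun r => {c | ∀ y ∈ Icc 0 r.1, ‖χ y + c * θ y‖ ^ 2 ≤ 1 - y / R.toReal}
  have hanti : Antitone K := fun r s hrs c hc y hy => hc y ⟨hy.1, hy.2.trans hrs⟩
  have hclosed : ∀ r, IsClosed (K r) := by
    intro r
    simp only [K, ofPred_forall]
    exact isClosed_biInter fun y _ => isClosed_le (by fun_prop) continuous_const
  have hcompact : ∀ r, IsCompact (K r) := by
    intro r
    refine Metric.isCompact_of_isClosed_isBounded (hclosed r) ?_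
    refine isBounded_iff_forall_norm_le.2 ⟨(1 + ‖χ r.1‖) / ‖θ r.1‖, fun c hc => ?_⟩
    rw [le_div_iff₀ (norm_pos_iff.2 (hθr r.1 r.2.1 r.2.2)), ← norm_mul]
    have h1 := hc r.1 ⟨r.2.2.le, le_rfl⟩
    have h2 : 0 ≤ r.1 / R.toReal := div_nonneg r.2.2.le ENNReal.toReal_nonneg
    have h3 : ‖χ r.1 + c * θ r.1‖ ≤ 1 := by
      rw [← sq_le_one_iff₀ (norm_nonneg _)]; linarith
    have h4 := norm_sub_le (χ r.1 + c * θ r.1) (χ r.1)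
    rw [add_sub_cancel_left] at h4
    linarith
  have hne : ∀ r, (K r).Nonempty := by
    intro r
    refine ⟨-(χ r.1 / θ r.1), fun y hy => ?_⟩
    have hr := hθr r.1 r.2.1 r.2.2
    have h1 := ((hχ.add_const_mul hθ (-(χ r.1 / θ r.1))).convexOn_normSq ha).le_lerp h0
      r.2.1 r.2.2 hy.1 hy.2
    have h2 : χ r.1 + -(χ r.1 / θ r.1) * θ r.1 = 0 := by field_simp; ring
    simp only [h2, hχ0, hθ0] at h1
    have h3 : y / R.toReal ≤ y / r.1 := by
      by_cases hRt : R = ⊤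
      · simpa [hRt] using div_nonneg hy.1 r.2.2.le
      · exact div_le_div_of_nonneg_left hy.1 r.2.2
          ((ENNReal.ofReal_le_iff_le_toReal hRt).1 r.2.1.2.le)
    refine h1.trans ?_
    simp
    linarith
  obtain ⟨c, hc⟩ := IsCompact.nonempty_iInter_of_directed_nonempty_isCompact_isClosed K
    hanti.directed_ge hne hcompact hclosed
  refine ⟨c, fun y hy => ?_⟩
  obtain ⟨z, hz, hyz⟩ := exists_gt_mem_IsetOf hy
  exact mem_iInter.1 hc ⟨z, hz, hy.1.trans_lt hyz⟩ y ⟨hy.1, hyz.le⟩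

/-- For every `R ∈ (0, ∞]`, every locally finite nonnegative Borel
measure `a` on `[0, R)`, every locally square-integrable `b : [0, R) → ℝ` and every
`ξ > 0`, the boundary-value problem (★) has exactly one solution `φ`. -/
theorem statement6 (R : ℝ≥0∞) (hR : 0 < R) (a : Measure ℝ)
    (ha : LocallyFiniteOnHalf R a) (b : ℝ → ℝ) (hbmeas : Measurable b)
    (hb : LocL2OnHalf R b) (ξ : ℝ) (hξ : 0 < ξ) :
    ∃ φ v : ℝ → ℂ, IsStarSolution R a b ξ φ v ∧
      ∀ φ' v' : ℝ → ℂ, IsStarSolution R a b ξ φ' v' →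
        ∀ y ∈ IsetOf R, φ' y = φ y := by
  obtain ⟨χ, χ', hχ, hχ0, -, -⟩ := exists_isODESolution hR ha hbmeas hb hξ 1 0
  obtain ⟨θ, θ', hθ, hθ0, hθ'0, hθc⟩ := exists_isODESolution hR ha hbmeas hb hξ 0 1
  obtain ⟨c, hc⟩ := exists_slope hR ha hχ hθ hχ0 hθ0 fun r hr hr0 =>
    hθ.ne_zero_of_deriv_zero_ne_zero ha hθ0 (by simp [hθ'0]) hθc hr hr0
  have hsol := hχ.add_const_mul hθ c
  have hstar : IsStarSolution R a b ξ (fun t => χ t + c * θ t) (fun t => χ' t + c * θ' t) :=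
    { init := by simp [hχ0, hθ0]
      deriv_integrable := hsol.int_v
      locAC := fun y hy => by rw [hsol.rep y hy]; simp [hχ0, hθ0]
      right_cont := fun y hy hy0 => hsol.continuousWithinAt_deriv hy fun z hz hyz =>
        hsol.eqn y z hy0 hyz hz
      bounded := ⟨1, fun y hy => by
        have := hc y hy
        have h2 : 0 ≤ y / R.toReal := div_nonneg hy.1 ENNReal.toReal_nonneg
        rw [← sq_le_one_iff₀ (norm_nonneg _)]
        linarith⟩
      boundary := fun hRt => by
        have hRpos : 0 < R.toReal := ENNReal.toReal_pos hR.ne' hRt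
        have t1 : Tendsto (fun y : ℝ => √(1 - y / R.toReal)) (𝓝[<] R.toReal) (𝓝 0) := by
          have : ContinuousAt (fun y : ℝ => √(1 - y / R.toReal)) R.toReal := by fun_prop
          have := this.tendsto
          simp only [div_self hRpos.ne', sub_self, Real.sqrt_zero] at this
          exact this.mono_left nhdsWithin_le_nhds
        refine squeeze_zero_norm' ?_ t1
        filter_upwards [self_mem_nhdsWithin, mem_nhdsWithin_of_mem_nhds (Ioi_mem_nhds hRpos)]
          with y hyR hy0
        exact Real.le_sqrt_of_sq_le
          (hc y ⟨le_of_lt hy0, (ENNReal.ofReal_lt_iff_lt_toReal (le_of_lt hy0) hRt).2 hyR⟩)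
      integ_a := hsol.int_a
      integ_vb := hsol.int_vb
      integ_φb := hsol.int_φb
      eqn := hsol.eqn }
  refine ⟨_, _, hstar, fun φ' v' h' y hy => ?_⟩
  have hdiff := h'.isODESolution.add_const_mul hsol (-1)
  obtain ⟨M₁, hM₁⟩ := h'.bounded
  obtain ⟨M₂, hM₂⟩ := hstar.bounded
  have hzero := eq_zero_of_convexOn (hdiff.convexOn_normSq ha) (fun _ => sq_nonneg _)
    (by simp [h'.init, hχ0, hθ0])
    ⟨(M₁ + M₂) ^ 2, fun z hz => by
      refine pow_le_pow_left₀ (norm_nonneg _) ((norm_add_le _ _).trans ?_) 2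
      rw [norm_mul, norm_neg, norm_one, one_mul]
      exact add_le_add (hM₁ z hz) (hM₂ z hz)⟩
    (fun hRt => by
      have := (((h'.boundary hRt).add ((hstar.boundary hRt).const_mul (-1))).norm).pow 2
      simpa using this) hy
  have h2 := norm_eq_zero.1 (pow_eq_zero_iff two_ne_zero |>.1 hzero)
  linear_combination h2
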